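/- Let f be a profile function and let Λ : ℕ → ℝ be the strictly increasing enumeration of E(f) = ⋃_{k ≥ 0} Spec L_k. For each m, define the multiplicity dim E_{Λ(m)} = 2·card{k : ℕ | k ≥ 1 and Λ(m) ∈ Spec L_k} + (1 if Λ(m) ∈ Spec L_0, else 0). Then dim E_{Λ(m)} ≤ 2m + 1 for all m. -/

import Mathlib

open Set MeasureTheory intervalIntegral Filter
open scoped Classical

/-- A profile function for a surface of revolution diffeomorphic to `S²` of area `4π`:
continuous on `[-1,1]`, smooth and positive on `(-1,1)`, vanishing at `±1`,
with derivative `2` at `-1` and `-2` at `1`. -/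
structure IsProfile (f : ℝ → ℝ) : Prop where
  contOn : ContinuousOn f (Icc (-1) 1)
  smoothOn : ContDiffOn ℝ (⊤ : ℕ∞) f (Ioo (-1) 1)
  pos : ∀ x ∈ Ioo (-1:ℝ) 1, 0 < f x
  zero_neg_one : f (-1) = 0
  zero_one : f 1 = 0
  deriv_neg_one : HasDerivAt f 2 (-1)
  deriv_one : HasDerivAt f (-2) 1

/-- `λ` is an eigenvalue of the Sturm–Liouville operator
`L_k = -(d/dx)(f(x) d/dx) + k²/f(x)` on `(-1,1)`, with Dirichlet boundary
conditions at `±1` when `k ≥ 1`. -/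
def InSpec (f : ℝ → ℝ) (k : ℕ) (lam : ℝ) : Prop :=
  ∃ u : ℝ → ℝ, ContinuousOn u (Icc (-1) 1) ∧ ContDiffOn ℝ (⊤ : ℕ∞) u (Ioo (-1) 1) ∧
    (∃ x ∈ Ioo (-1:ℝ) 1, u x ≠ 0) ∧
    (1 ≤ k → u (-1) = 0 ∧ u 1 = 0) ∧
    ∀ x ∈ Ioo (-1:ℝ) 1,
      -(deriv (fun y => f y * deriv u y) x) + ((k:ℝ)^2 / f x) * u x = lam * u x

/-- The spectrum of `L_k`. -/
def Spec (f : ℝ → ℝ) (k : ℕ) : Set ℝ := {lam | InSpec f k lam}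

/-- The set of distinct eigenvalues of the Laplacian of the surface of
revolution determined by `f`. -/
def Eigs (f : ℝ → ℝ) : Set ℝ := ⋃ k : ℕ, Spec f k

open scoped Topology

/-- A coordinate `t` on `(-1,1)` with `dt = dx / f`, running from `-∞` to `+∞`. -/
structure IsLogCoord (f t : ℝ → ℝ) : Prop where
  hasDerivAt : ∀ x ∈ Ioo (-1:ℝ) 1, HasDerivAt t (1 / f x) x
  tendsto_atTop : Tendsto t (𝓝[<] 1) atTop
  tendsto_atBot : Tendsto t (𝓝[>] (-1)) atBot

theorem tendsto_atTop_of_hasDerivAt_one_div {f t : ℝ → ℝ} {d : ℝ}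
    (hpos : ∀ x ∈ Ioo (-1:ℝ) 1, 0 < f x) (hf1 : f 1 = 0) (hd : HasDerivAt f d 1)
    (ht : ∀ x ∈ Ioo (-1:ℝ) 1, HasDerivAt t (1 / f x) x) :
    Tendsto t (𝓝[<] 1) atTop := by
  obtain ⟨C, hC0, hC⟩ := hd.isBigO_sub.exists_pos
  have hev := hC.bound
  rw [Metric.eventually_nhds_iff] at hev
  obtain ⟨δ, hδ, hbd⟩ := hev
  set a := max 0 (1 - δ / 2) with ha
  have ha0 : 0 ≤ a := le_max_left _ _
  have haδ : 1 - δ / 2 ≤ a := le_max_right _ _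
  have ha1 : a < 1 := max_lt one_pos (by linarith)
  have hfb : ∀ x ∈ Ico a 1, f x ≤ C * (1 - x) := by
    intro x hx
    have h := hbd (y := x) (by rw [Real.dist_eq, abs_lt]; constructor <;> linarith [hx.1, hx.2])
    rw [hf1, sub_zero, Real.norm_eq_abs, Real.norm_eq_abs, abs_of_neg (by linarith [hx.2] : x - 1 < 0)] at h
    linarith [le_abs_self (f x)]
  have hmono : MonotoneOn (fun x => t x + (1 / C) * Real.log (1 - x)) (Ico a 1) := by
    have hder : ∀ x ∈ Ico a 1, HasDerivAt (fun x => t x + (1 / C) * Real.log (1 - x))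
        (1 / f x + (1 / C) * (-1 / (1 - x))) x := by
      intro x hx
      have h1 : HasDerivAt (fun x : ℝ => 1 - x) (-1) x := by
        simpa using (hasDerivAt_id x).const_sub 1
      exact (ht x ⟨by linarith [hx.1], hx.2⟩).add
        ((h1.log (by linarith [hx.2])).const_mul _)
    refine monotoneOn_of_deriv_nonneg (convex_Ico a 1)
      (fun x hx => (hder x hx).continuousAt.continuousWithinAt)
      (fun x hx => (hder x (interior_subset hx)).differentiableAt.differentiableWithinAt) ?_
    intro x hx
    have hx' := interior_subset hx
    rw [(hder x hx').deriv]
    have hfx := hpos x ⟨by linarith [hx'.1], hx'.2⟩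
    have h1x : 0 < 1 - x := by linarith [hx'.2]
    have := one_div_le_one_div_of_le hfx (hfb x hx')
    have h2 : (1 / C) * (-1 / (1 - x)) = -(1 / (C * (1 - x))) := by
      field_simp
    linarith
  have hlog : Tendsto (fun x : ℝ => (t a + (1 / C) * Real.log (1 - a)) +
      (1 / C) * (-Real.log (1 - x))) (𝓝[<] 1) atTop := by
    refine tendsto_atTop_add_const_left _ _ (Tendsto.const_mul_atTop (by positivity) ?_)
    refine tendsto_neg_atBot_atTop.comp (Real.tendsto_log_nhdsGT_zero.comp ?_)
    refine tendsto_nhdsWithin_iff.2 ⟨?_, ?_⟩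
    · have : Tendsto (fun x : ℝ => 1 - x) (𝓝 1) (𝓝 (1 - 1)) := by
        exact (continuous_const.sub continuous_id).tendsto 1
      rw [sub_self] at this
      exact this.mono_left nhdsWithin_le_nhds
    · filter_upwards [self_mem_nhdsWithin] with x hx
      have : x < 1 := hx
      simpa using this
  refine tendsto_atTop_mono' _ ?_ hlog
  filter_upwards [Ico_mem_nhdsLT ha1] with x hx
  have := hmono ⟨le_rfl, ha1⟩ hx hx.1
  simp only at this
  linarith

theorem IsProfile.exists_isLogCoord {f : ℝ → ℝ} (hf : IsProfile f) :
    ∃ t, IsLogCoord f t := by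
  have hcont : ContinuousOn (fun x => 1 / f x) (Ioo (-1) 1) :=
    continuousOn_const.div hf.smoothOn.continuousOn fun x hx => (hf.pos x hx).ne'
  have hder : ∀ x ∈ Ioo (-1:ℝ) 1, HasDerivAt (fun x => ∫ y in (0:ℝ)..x, 1 / f y) (1 / f x) x := by
    intro x hx
    have hsub : uIcc 0 x ⊆ Ioo (-1:ℝ) 1 :=
      (ordConnected_Ioo (a := (-1:ℝ)) (b := 1)).uIcc_subset (by norm_num) hx
    exact integral_hasDerivAt_right (hcont.mono hsub).intervalIntegrable
      (hcont.stronglyMeasurableAtFilter isOpen_Ioo x hx)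
      (hcont.continuousAt (isOpen_Ioo.mem_nhds hx))
  refine ⟨_, hder, tendsto_atTop_of_hasDerivAt_one_div hf.pos hf.zero_one hf.deriv_one hder, ?_⟩
  have hneg : ∀ x ∈ Ioo (-1:ℝ) 1, -x ∈ Ioo (-1:ℝ) 1 := fun x hx =>
    ⟨by linarith [hx.2], by linarith [hx.1]⟩
  have h := tendsto_atTop_of_hasDerivAt_one_div (f := fun x => f (-x)) (d := -2)
    (t := fun x => -∫ y in (0:ℝ)..(-x), 1 / f y)
    (fun x hx => hf.pos _ (hneg x hx)) hf.zero_neg_one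
    (by
      have := hf.deriv_neg_one.comp_of_eq (h := fun x : ℝ => -x) 1 (hasDerivAt_neg 1) rfl
      exact this.congr_deriv (by norm_num))
    (fun x hx => by
      have := ((hder _ (hneg x hx)).comp x (hasDerivAt_neg x)).neg
      exact this.congr_deriv (by ring))
  have h2 := tendsto_neg_atTop_atBot.comp (h.comp tendsto_neg_nhdsGT_neg)
  refine h2.congr fun x => ?_
  simp

theorem IsLogCoord.continuousOn {f t : ℝ → ℝ} (ht : IsLogCoord f t) :
    ContinuousOn t (Ioo (-1) 1) :=
  fun x hx => (ht.hasDerivAt x hx).continuousAt.continuousWithinAt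

theorem IsLogCoord.monotoneOn {f t : ℝ → ℝ} (hf : IsProfile f) (ht : IsLogCoord f t) :
    MonotoneOn t (Ioo (-1) 1) := by
  refine monotoneOn_of_deriv_nonneg (convex_Ioo _ _) ht.continuousOn
    (fun x hx => (ht.hasDerivAt x (interior_subset hx)).differentiableAt.differentiableWithinAt) ?_
  intro x hx
  have hx' := interior_subset hx
  rw [(ht.hasDerivAt x hx').deriv]
  exact (one_div_pos.2 (hf.pos x hx')).le

/-- An antiderivative on `(-1,1)` of a `C^n` function is `C^(n+1)`. -/
theorem contDiffOn_succ_of_hasDerivAt {g g' : ℝ → ℝ} {n : ℕ}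
    (hg : ∀ x ∈ Ioo (-1:ℝ) 1, HasDerivAt g (g' x) x) (hg' : ContDiffOn ℝ n g' (Ioo (-1) 1)) :
    ContDiffOn ℝ (n + 1 : ℕ) g (Ioo (-1) 1) := by
  have := (contDiffOn_succ_iff_deriv_of_isOpen (𝕜 := ℝ) (n := (n : WithTop ℕ∞)) (f := g)
    (isOpen_Ioo (a := (-1:ℝ)) (b := 1))).2
    ⟨fun x hx => (hg x hx).differentiableAt.differentiableWithinAt, by simp,
      hg'.congr fun x hx => (hg x hx).deriv⟩
  exact_mod_cast this

theorem IsLogCoord.contDiffOn {f t : ℝ → ℝ} (hf : IsProfile f) (ht : IsLogCoord f t) (n : ℕ) :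
    ContDiffOn ℝ n t (Ioo (-1) 1) := by
  refine (contDiffOn_succ_of_hasDerivAt ht.hasDerivAt ?_).of_le (m := n) (by exact_mod_cast n.le_succ)
  exact contDiffOn_const.div (hf.smoothOn.of_le (by exact_mod_cast le_top)) fun x hx => (hf.pos x hx).ne'

/-- `exp (2jt)`, extended by `0` to the left of `-1`. -/
noncomputable def growth (t : ℝ → ℝ) (j x : ℝ) : ℝ := if -1 < x then Real.exp (2 * j * t x) else 0

/-- `exp (-2jt)`, extended by `0` to the right of `1`. -/
noncomputable def decay (t : ℝ → ℝ) (j x : ℝ) : ℝ := if x < 1 then Real.exp (-(2 * j * t x)) else 0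

/-- The Volterra kernel `(1 - exp (-2j (t x - t y)))⁺`. -/
noncomputable def volterraKernel (t : ℝ → ℝ) (j x y : ℝ) : ℝ :=
  if x ≤ -1 then 0 else max 0 (1 - growth t j y * decay t j x)

theorem growth_nonneg (t : ℝ → ℝ) (j x : ℝ) : 0 ≤ growth t j x := by
  unfold growth; split_ifs <;> positivity

theorem decay_nonneg (t : ℝ → ℝ) (j x : ℝ) : 0 ≤ decay t j x := by
  unfold decay; split_ifs <;> positivity

theorem growth_of_mem (t : ℝ → ℝ) (j : ℝ) {x : ℝ} (hx : x ∈ Ioo (-1:ℝ) 1) :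
    growth t j x = Real.exp (2 * j * t x) := if_pos hx.1

theorem decay_of_mem (t : ℝ → ℝ) (j : ℝ) {x : ℝ} (hx : x ∈ Ioo (-1:ℝ) 1) :
    decay t j x = Real.exp (-(2 * j * t x)) := if_pos hx.2

theorem growth_mul_decay (t : ℝ → ℝ) (j : ℝ) {x : ℝ} (hx : x ∈ Ioo (-1:ℝ) 1) :
    growth t j x * decay t j x = 1 := by
  rw [growth_of_mem t j hx, decay_of_mem t j hx, ← Real.exp_add]; simp

theorem volterraKernel_nonneg (t : ℝ → ℝ) (j x y : ℝ) : 0 ≤ volterraKernel t j x y := by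
  unfold volterraKernel; split_ifs <;> simp

theorem volterraKernel_le_one (t : ℝ → ℝ) (j x y : ℝ) : volterraKernel t j x y ≤ 1 := by
  unfold volterraKernel
  split_ifs
  · simp
  · have := mul_nonneg (growth_nonneg t j y) (decay_nonneg t j x)
    exact max_le zero_le_one (by linarith)

theorem volterraKernel_one (t : ℝ → ℝ) (j y : ℝ) : volterraKernel t j 1 y = 1 := by
  simp [volterraKernel, decay]

namespace IsLogCoord

variable {f t : ℝ → ℝ} {j : ℝ}

theorem antitoneOn_decay (hf : IsProfile f) (ht : IsLogCoord f t) (hj : 0 < j) :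
    AntitoneOn (decay t j) (Ioi (-1)) := by
  intro x hx x' hx' hxx
  by_cases h1 : x' < 1
  · have hx1 : x < 1 := hxx.trans_lt h1
    rw [decay_of_mem t j ⟨hx, hx1⟩, decay_of_mem t j ⟨hx', h1⟩]
    have := ht.monotoneOn hf ⟨hx, hx1⟩ ⟨hx', h1⟩ hxx
    gcongr
  · rw [show decay t j x' = 0 from if_neg h1]
    exact decay_nonneg t j x

theorem continuousOn_growth (ht : IsLogCoord f t) (hj : 0 < j) :
    ContinuousOn (growth t j) (Iio 1) := by
  intro x hx
  refine ContinuousAt.continuousWithinAt ?_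
  rcases lt_trichotomy x (-1) with h | h | h
  · refine continuousAt_const.congr (f := fun _ => (0:ℝ)) ?_
    filter_upwards [Iio_mem_nhds h] with y hy
    exact (if_neg (not_lt.2 (le_of_lt hy))).symm
  · subst h
    have h0 : growth t j (-1) = 0 := if_neg (lt_irrefl _)
    have hR : Tendsto (growth t j) (𝓝[>] (-1)) (𝓝 0) := by
      refine (Real.tendsto_exp_atBot.comp
        (ht.tendsto_atBot.const_mul_atBot (by positivity : 0 < 2 * j))).congr' ?_
      filter_upwards [self_mem_nhdsWithin] with y hy
      exact (if_pos hy).symm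
    have hL : Tendsto (growth t j) (𝓝[≤] (-1)) (𝓝 0) := by
      refine tendsto_const_nhds.congr' ?_
      filter_upwards [self_mem_nhdsWithin] with y hy
      exact (if_neg (not_lt.2 hy)).symm
    rw [ContinuousAt, h0, ← nhdsLE_sup_nhdsGT]
    exact hL.sup hR
  · have hx' : x ∈ Ioo (-1:ℝ) 1 := ⟨h, hx⟩
    have : ContinuousAt (fun y => Real.exp (2 * j * t y)) x :=
      ((ht.hasDerivAt x hx').continuousAt.const_mul _).rexp
    refine this.congr ?_
    filter_upwards [Ioi_mem_nhds h] with y hy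
    exact (if_pos hy).symm

theorem continuousOn_decay (ht : IsLogCoord f t) (hj : 0 < j) :
    ContinuousOn (decay t j) (Ioi (-1)) := by
  intro x hx
  refine ContinuousAt.continuousWithinAt ?_
  rcases lt_trichotomy x 1 with h | h | h
  · have hx' : x ∈ Ioo (-1:ℝ) 1 := ⟨hx, h⟩
    have : ContinuousAt (fun y => Real.exp (-(2 * j * t y))) x :=
      ((ht.hasDerivAt x hx').continuousAt.const_mul _).neg.rexp
    refine this.congr ?_
    filter_upwards [Iio_mem_nhds h] with y hy
    exact (if_pos hy).symm
  · subst h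
    have h0 : decay t j 1 = 0 := if_neg (lt_irrefl _)
    have hL : Tendsto (decay t j) (𝓝[<] 1) (𝓝 0) := by
      refine (Real.tendsto_exp_neg_atTop_nhds_zero.comp
        (ht.tendsto_atTop.const_mul_atTop (by positivity : 0 < 2 * j))).congr' ?_
      filter_upwards [self_mem_nhdsWithin] with y hy
      exact (if_pos hy).symm
    have hR : Tendsto (decay t j) (𝓝[≥] 1) (𝓝 0) := by
      refine tendsto_const_nhds.congr' ?_
      filter_upwards [self_mem_nhdsWithin] with y hy
      exact (if_neg (not_lt.2 hy)).symm
    rw [ContinuousAt, h0, ← nhdsLT_sup_nhdsGE]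
    exact hL.sup hR
  · refine continuousAt_const.congr (f := fun _ => (0:ℝ)) ?_
    filter_upwards [Ioi_mem_nhds h] with y hy
    exact (if_neg (not_lt.2 (le_of_lt hy))).symm

theorem volterraKernel_eq_zero (hf : IsProfile f) (ht : IsLogCoord f t) (hj : 0 < j) {x y : ℝ}
    (hy : y ∈ Ioo (-1:ℝ) 1) (hxy : x ≤ y) : volterraKernel t j x y = 0 := by
  unfold volterraKernel
  split_ifs with h
  · rfl
  · have := ht.antitoneOn_decay hf hj (not_le.1 h) hy.1 hxy
    have h2 := mul_le_mul_of_nonneg_left this (growth_nonneg t j y)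
    rw [growth_mul_decay t j hy] at h2
    exact max_eq_left (by linarith)

theorem volterraKernel_of_le (hf : IsProfile f) (ht : IsLogCoord f t) (hj : 0 < j) {x y : ℝ}
    (hy : y ∈ Ioo (-1:ℝ) 1) (hyx : y ≤ x) :
    volterraKernel t j x y = 1 - growth t j y * decay t j x := by
  have hx : -1 < x := hy.1.trans_le hyx
  have := ht.antitoneOn_decay hf hj hy.1 hx hyx
  have h2 := mul_le_mul_of_nonneg_left this (growth_nonneg t j y)
  rw [growth_mul_decay t j hy] at h2
  rw [volterraKernel, if_neg (not_le.2 hx)]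
  exact max_eq_right (by linarith)

theorem monotone_volterraKernel (hf : IsProfile f) (ht : IsLogCoord f t) (hj : 0 < j) (y : ℝ) :
    Monotone fun x => volterraKernel t j x y := by
  intro x x' hxx
  by_cases h : x ≤ -1
  · simpa [volterraKernel, h] using volterraKernel_nonneg t j x' y
  · have hx := not_le.1 h
    have hx' : -1 < x' := hx.trans_le hxx
    have := ht.antitoneOn_decay hf hj hx hx' hxx
    have h2 := mul_le_mul_of_nonneg_left this (growth_nonneg t j y)
    simp only [volterraKernel, h, not_le.2 hx', if_false]
    exact max_le_max_left _ (by linarith)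

theorem continuous_volterraKernel (hf : IsProfile f) (ht : IsLogCoord f t) (hj : 0 < j) {y : ℝ}
    (hy : y ∈ Ioo (-1:ℝ) 1) : Continuous fun x => volterraKernel t j x y := by
  rw [continuous_iff_continuousAt]
  intro x
  rcases lt_or_ge x y with h | h
  · refine continuousAt_const.congr (f := fun _ => (0:ℝ)) ?_
    filter_upwards [Iio_mem_nhds h] with z hz
    exact (ht.volterraKernel_eq_zero hf hj hy (le_of_lt hz)).symm
  · have hx : -1 < x := hy.1.trans_le h
    have hc : ContinuousAt (fun x => max 0 (1 - growth t j y * decay t j x)) x :=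
      continuousAt_const.max (continuousAt_const.sub (continuousAt_const.mul
        ((ht.continuousOn_decay hj).continuousAt (Ioi_mem_nhds hx))))
    refine hc.congr ?_
    filter_upwards [Ioi_mem_nhds hx] with z hz
    exact (if_neg (not_le.2 hz)).symm

theorem continuousOn_volterraKernel (ht : IsLogCoord f t) (hj : 0 < j) (x : ℝ) :
    ContinuousOn (fun y => volterraKernel t j x y) (Ioo (-1) 1) := by
  unfold volterraKernel
  split_ifs
  · exact continuousOn_const
  · exact ContinuousOn.sup continuousOn_const (continuousOn_const.sub
      (((ht.continuousOn_growth hj).mono fun y hy => hy.2).mul continuousOn_const))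

theorem integrableOn_volterraKernel_mul (ht : IsLogCoord f t) (hj : 0 < j) (x : ℝ) {φ : ℝ → ℝ}
    (hφ : ContinuousOn φ (Icc (-1) 1)) :
    IntegrableOn (fun y => volterraKernel t j x y * φ y) (Ioo (-1) 1) := by
  refine ((hφ.integrableOn_Icc (μ := volume)).mono_set Ioo_subset_Icc_self).bdd_mul (c := 1)
    ((ht.continuousOn_volterraKernel hj x).aestronglyMeasurable measurableSet_Ioo) ?_
  refine Eventually.of_forall fun y => ?_
  rw [Real.norm_eq_abs, abs_of_nonneg (volterraKernel_nonneg t j x y)]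
  exact volterraKernel_le_one t j x y

theorem continuous_integral_volterraKernel_mul (hf : IsProfile f) (ht : IsLogCoord f t)
    (hj : 0 < j) {φ : ℝ → ℝ} (hφ : ContinuousOn φ (Icc (-1) 1)) :
    Continuous fun x => ∫ y in Ioo (-1) 1, volterraKernel t j x y * φ y := by
  refine continuous_of_dominated (bound := fun y => ‖φ y‖)
    (fun x => (ht.integrableOn_volterraKernel_mul hj x hφ).aestronglyMeasurable) ?_
    ((hφ.integrableOn_Icc (μ := volume)).mono_set Ioo_subset_Icc_self).norm ?_
  · refine fun x => Eventually.of_forall fun y => ?_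
    rw [norm_mul, Real.norm_eq_abs, abs_of_nonneg (volterraKernel_nonneg t j x y)]
    exact mul_le_of_le_one_left (norm_nonneg _) (volterraKernel_le_one t j x y)
  · filter_upwards [ae_restrict_mem measurableSet_Ioo] with y hy
    exact (ht.continuous_volterraKernel hf hj hy).mul continuous_const

/-- Only the part of the integral to the left of `x` contributes. -/
theorem integral_volterraKernel_mul (hf : IsProfile f) (ht : IsLogCoord f t)
    (hj : 0 < j) {x : ℝ} (hx : x ∈ Icc (-1:ℝ) 1) (φ : ℝ → ℝ) :
    ∫ y in Ioo (-1) 1, volterraKernel t j x y * φ y =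
      ∫ y in (-1)..x, volterraKernel t j x y * φ y := by
  rw [integral_of_le hx.1, integral_Ioc_eq_integral_Ioo]
  refine (setIntegral_eq_of_subset_of_forall_sdiff_eq_zero measurableSet_Ioo
    (Ioo_subset_Ioo_right hx.2) fun y hy => ?_)
  rw [ht.volterraKernel_eq_zero hf hj hy.1, zero_mul]
  by_contra h
  exact hy.2 ⟨hy.1.1, not_le.1 h⟩

end IsLogCoord

/-- Iterates of the Volterra operator applied to the constant function `1`. -/
noncomputable def volterraIterate (t : ℝ → ℝ) (j : ℝ) : ℕ → ℝ → ℝ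
  | 0 => fun _ => 1
  | n + 1 => fun x => ∫ y in Ioo (-1) 1, volterraKernel t j x y * volterraIterate t j n y

/-- The solution of `v x = 1 - c ∫ y, volterraKernel t j x y * v y`, as a Neumann series. -/
noncomputable def volterraSolution (t : ℝ → ℝ) (j c x : ℝ) : ℝ :=
  ∑' n, (-c) ^ n * volterraIterate t j n x

namespace IsLogCoord

variable {f t : ℝ → ℝ} {j c : ℝ}

theorem continuous_volterraIterate (hf : IsProfile f) (ht : IsLogCoord f t) (hj : 0 < j) (n : ℕ) :
    Continuous (volterraIterate t j n) := by
  induction n with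
  | zero => exact continuous_const
  | succ n ih => exact ht.continuous_integral_volterraKernel_mul hf hj ih.continuousOn

theorem abs_volterraIterate_le_pow (hf : IsProfile f) (ht : IsLogCoord f t) (hj : 0 < j) (n : ℕ) :
    ∀ x ∈ Icc (-1:ℝ) 1, |volterraIterate t j n x| ≤ (x + 1) ^ n / n.factorial := by
  induction n with
  | zero => simp [volterraIterate]
  | succ n ih =>
    intro x hx
    have hint : ∫ y in (-1)..x, (y + 1) ^ n / n.factorial =
        (x + 1) ^ (n + 1) / (n + 1).factorial := by
      rw [intervalIntegral.integral_div, intervalIntegral.integral_comp_add_right (fun y => y ^ n), integral_pow]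
      rw [Nat.factorial_succ]
      push_cast
      field_simp
      simp
    simp only [volterraIterate]
    rw [ht.integral_volterraKernel_mul hf hj hx, ← hint, ← Real.norm_eq_abs]
    refine norm_integral_le_of_norm_le hx.1 (Eventually.of_forall fun y hy => ?_)
      (Continuous.intervalIntegrable (by fun_prop) _ _)
    rw [norm_mul, Real.norm_eq_abs, Real.norm_eq_abs,
      abs_of_nonneg (volterraKernel_nonneg t j x y)]
    exact (mul_le_of_le_one_left (abs_nonneg _) (volterraKernel_le_one t j x y)).trans
      (ih y ⟨hy.1.le, hy.2.trans hx.2⟩)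

theorem abs_volterraIterate_le (hf : IsProfile f) (ht : IsLogCoord f t) (hj : 0 < j) (n : ℕ)
    {x : ℝ} (hx : x ∈ Icc (-1:ℝ) 1) : |volterraIterate t j n x| ≤ 2 ^ n / n.factorial := by
  refine (ht.abs_volterraIterate_le_pow hf hj n x hx).trans ?_
  have : 0 ≤ x + 1 := by linarith [hx.1]
  gcongr
  linarith [hx.2]

theorem norm_pow_mul_volterraIterate_le (hf : IsProfile f) (ht : IsLogCoord f t) (hj : 0 < j)
    {C : ℝ} (hc : |c| ≤ C) (n : ℕ) {x : ℝ} (hx : x ∈ Icc (-1:ℝ) 1) :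
    ‖(-c) ^ n * volterraIterate t j n x‖ ≤ (C * 2) ^ n / n.factorial := by
  rw [norm_mul, norm_pow, norm_neg, Real.norm_eq_abs, Real.norm_eq_abs, mul_pow, mul_div_assoc]
  exact mul_le_mul (pow_le_pow_left₀ (abs_nonneg c) hc n)
    (ht.abs_volterraIterate_le hf hj n hx) (abs_nonneg _)
    (pow_nonneg ((abs_nonneg c).trans hc) n)

theorem continuousOn_volterraSolution_uncurry (hf : IsProfile f) (ht : IsLogCoord f t)
    (hj : 0 < j) (C : ℝ) :
    ContinuousOn (fun p : ℝ × ℝ => volterraSolution t j p.1 p.2) (Icc (-C) C ×ˢ Icc (-1) 1) := by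
  refine continuousOn_tsum (u := fun n : ℕ => (C * 2) ^ n / n.factorial) (fun n => ?_)
    (Real.summable_pow_div_factorial _) fun n p hp => ?_
  · have := ht.continuous_volterraIterate hf hj n
    fun_prop
  · exact ht.norm_pow_mul_volterraIterate_le hf hj (abs_le.2 hp.1) n hp.2

theorem continuousOn_volterraSolution (hf : IsProfile f) (ht : IsLogCoord f t)
    (hj : 0 < j) (c : ℝ) : ContinuousOn (volterraSolution t j c) (Icc (-1) 1) :=
  (ht.continuousOn_volterraSolution_uncurry hf hj |c|).comp (f := fun x => (c, x))
    (by fun_prop) fun _ hx => ⟨abs_le.1 le_rfl, hx⟩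

theorem volterraSolution_eq (hf : IsProfile f) (ht : IsLogCoord f t) (hj : 0 < j) (c : ℝ)
    {x : ℝ} (hx : x ∈ Icc (-1:ℝ) 1) :
    volterraSolution t j c x =
      1 - c * ∫ y in Ioo (-1) 1, volterraKernel t j x y * volterraSolution t j c y := by
  have hbd := fun n => fun y hy =>
    ht.norm_pow_mul_volterraIterate_le hf hj (c := c) le_rfl n (x := y) hy
  have hsum : ∀ y ∈ Icc (-1:ℝ) 1, Summable fun n => (-c) ^ n * volterraIterate t j n y :=
    fun y hy => Summable.of_norm_bounded (Real.summable_pow_div_factorial (|c| * 2))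
      fun n => hbd n y hy
  have hint : HasSum (fun n => ∫ y in Ioo (-1) 1,
        volterraKernel t j x y * ((-c) ^ n * volterraIterate t j n y))
      (∫ y in Ioo (-1) 1, volterraKernel t j x y * volterraSolution t j c y) := by
    refine hasSum_integral_of_dominated_convergence
      (fun n _ => (|c| * 2) ^ n / n.factorial) (fun n => ?_) (fun n => ?_) ?_ ?_ ?_
    · exact (ht.integrableOn_volterraKernel_mul hj x (φ := fun y => (-c) ^ n * volterraIterate t j n y)
        (continuous_const.mul (ht.continuous_volterraIterate hf hj n)).continuousOn).aestronglyMeasurable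
    · filter_upwards [ae_restrict_mem measurableSet_Ioo] with y hy
      rw [norm_mul, Real.norm_eq_abs, abs_of_nonneg (volterraKernel_nonneg t j x y)]
      exact (mul_le_of_le_one_left (norm_nonneg _) (volterraKernel_le_one t j x y)).trans
        (hbd n y (Ioo_subset_Icc_self hy))
    · exact Eventually.of_forall fun _ => Real.summable_pow_div_factorial _
    · simp
    · filter_upwards [ae_restrict_mem measurableSet_Ioo] with y hy
      exact (hsum y (Ioo_subset_Icc_self hy)).hasSum.mul_left _
  have hstep : ∀ n, (-c) ^ (n + 1) * volterraIterate t j (n + 1) x = -c * ∫ y in Ioo (-1) 1,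
      volterraKernel t j x y * ((-c) ^ n * volterraIterate t j n y) := by
    intro n
    rw [volterraIterate, pow_succ, mul_comm ((-c) ^ n) (-c), mul_assoc, ← MeasureTheory.integral_const_mul]
    congr 2
    ext y
    ring
  rw [volterraSolution, (hsum x hx).tsum_eq_zero_add]
  simp_rw [hstep]
  rw [tsum_mul_left, hint.tsum_eq]
  simp [volterraIterate]
  ring

theorem volterraSolution_neg_one (hf : IsProfile f) (ht : IsLogCoord f t) (hj : 0 < j) (c : ℝ) :
    volterraSolution t j c (-1) = 1 := by
  rw [ht.volterraSolution_eq hf hj c (by norm_num), ht.integral_volterraKernel_mul hf hj (by norm_num)]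
  simp

theorem volterraSolution_one (hf : IsProfile f) (ht : IsLogCoord f t) (hj : 0 < j) (c : ℝ) :
    volterraSolution t j c 1 = 1 - c * ∫ y in (-1)..1, volterraSolution t j c y := by
  rw [ht.volterraSolution_eq hf hj c (by norm_num), ht.integral_volterraKernel_mul hf hj (by norm_num)]
  simp [volterraKernel_one]

theorem continuousOn_growth_mul_volterraSolution (hf : IsProfile f) (ht : IsLogCoord f t)
    (hj : 0 < j) (c : ℝ) {x : ℝ} (hx : x < 1) :
    ContinuousOn (fun y => growth t j y * volterraSolution t j c y) (Icc (-1) x) :=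
  ((ht.continuousOn_growth hj).mono fun _ hy => hy.2.trans_lt hx).mul
    ((ht.continuousOn_volterraSolution hf hj c).mono (Icc_subset_Icc_right hx.le))

theorem volterraSolution_of_mem (hf : IsProfile f) (ht : IsLogCoord f t) (hj : 0 < j) (c : ℝ)
    {x : ℝ} (hx : x ∈ Ioo (-1:ℝ) 1) :
    volterraSolution t j c x = 1 - c * ((∫ y in (-1)..x, volterraSolution t j c y) -
      decay t j x * ∫ y in (-1)..x, growth t j y * volterraSolution t j c y) := by
  have h1 : ∫ y in (-1)..x, volterraKernel t j x y * volterraSolution t j c y =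
      ∫ y in (-1)..x, (volterraSolution t j c y -
        decay t j x * (growth t j y * volterraSolution t j c y)) := by
    refine integral_congr_Ioo_of_le hx.1.le fun y hy => ?_
    rw [ht.volterraKernel_of_le hf hj ⟨hy.1, hy.2.trans hx.2⟩ hy.2.le]
    ring
  rw [ht.volterraSolution_eq hf hj c (Ioo_subset_Icc_self hx),
    ht.integral_volterraKernel_mul hf hj (Ioo_subset_Icc_self hx), h1, intervalIntegral.integral_sub,
    intervalIntegral.integral_const_mul]
  · exact ((ht.continuousOn_volterraSolution hf hj c).mono
      (Icc_subset_Icc_right hx.2.le)).intervalIntegrable_of_Icc hx.1.le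
  · exact ((ht.continuousOn_growth_mul_volterraSolution hf hj c hx.2).intervalIntegrable_of_Icc
      hx.1.le).const_mul _

end IsLogCoord

/-- The weighted integral `∫ exp (2jt) v` of the Volterra solution `v` from `-1` to `x`. -/
noncomputable def weightedIntegral (t : ℝ → ℝ) (j c x : ℝ) : ℝ :=
  ∫ y in (-1)..x, growth t j y * volterraSolution t j c y

/-- The flux `f * w'` of the mode `w = exp (jt) v`. -/
noncomputable def modeFlux (t : ℝ → ℝ) (j c x : ℝ) : ℝ :=
  Real.exp (j * t x) * (j * volterraSolution t j c x -
    2 * j * c * (Real.exp (-(2 * j * t x)) * weightedIntegral t j c x))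

namespace IsLogCoord

variable {f t : ℝ → ℝ} {j : ℝ}

theorem hasDerivAt_integral_volterraSolution (hf : IsProfile f) (ht : IsLogCoord f t) (hj : 0 < j)
    (c : ℝ) {x : ℝ} (hx : x ∈ Ioo (-1:ℝ) 1) :
    HasDerivAt (fun x => ∫ y in (-1)..x, volterraSolution t j c y) (volterraSolution t j c x) x := by
  have hc := ht.continuousOn_volterraSolution hf hj c
  have hc' := hc.mono Ioo_subset_Icc_self
  exact integral_hasDerivAt_right
    ((hc.mono (Icc_subset_Icc_right hx.2.le)).intervalIntegrable_of_Icc hx.1.le)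
    (hc'.stronglyMeasurableAtFilter isOpen_Ioo x hx) (hc'.continuousAt (isOpen_Ioo.mem_nhds hx))

theorem hasDerivAt_weightedIntegral (hf : IsProfile f) (ht : IsLogCoord f t) (hj : 0 < j)
    (c : ℝ) {x : ℝ} (hx : x ∈ Ioo (-1:ℝ) 1) :
    HasDerivAt (weightedIntegral t j c) (Real.exp (2 * j * t x) * volterraSolution t j c x) x := by
  have hc' : ContinuousOn (fun y => growth t j y * volterraSolution t j c y) (Ioo (-1) 1) :=
    ((ht.continuousOn_growth hj).mono fun _ hy => hy.2).mul
      ((ht.continuousOn_volterraSolution hf hj c).mono Ioo_subset_Icc_self)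
  rw [← growth_of_mem t j hx]
  exact integral_hasDerivAt_right
    ((ht.continuousOn_growth_mul_volterraSolution hf hj c hx.2).intervalIntegrable_of_Icc hx.1.le)
    (hc'.stronglyMeasurableAtFilter isOpen_Ioo x hx) (hc'.continuousAt (isOpen_Ioo.mem_nhds hx))

theorem volterraSolution_eq_of_mem (hf : IsProfile f) (ht : IsLogCoord f t) (hj : 0 < j) (c : ℝ)
    {x : ℝ} (hx : x ∈ Ioo (-1:ℝ) 1) :
    volterraSolution t j c x = 1 - c * ((∫ y in (-1)..x, volterraSolution t j c y) -
      Real.exp (-(2 * j * t x)) * weightedIntegral t j c x) := by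
  rw [← decay_of_mem t j hx]
  exact ht.volterraSolution_of_mem hf hj c hx

theorem hasDerivAt_volterraSolution (hf : IsProfile f) (ht : IsLogCoord f t) (hj : 0 < j)
    (c : ℝ) {x : ℝ} (hx : x ∈ Ioo (-1:ℝ) 1) :
    HasDerivAt (volterraSolution t j c)
      (-(2 * j * c * (Real.exp (-(2 * j * t x)) * weightedIntegral t j c x)) / f x) x := by
  have hexp := ((ht.hasDerivAt x hx).const_mul (2 * j)).neg.exp
  have h := (((ht.hasDerivAt_integral_volterraSolution hf hj c hx).sub
    (hexp.mul (ht.hasDerivAt_weightedIntegral hf hj c hx))).const_mul c).const_sub 1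
  refine (h.congr_of_eventuallyEq ?_).congr_deriv ?_
  · filter_upwards [isOpen_Ioo.mem_nhds hx] with y hy
    exact ht.volterraSolution_eq_of_mem hf hj c hy
  · have hne := (hf.pos x hx).ne'
    have h1 : Real.exp (-(2 * j * t x)) * Real.exp (2 * j * t x) = 1 := by
      rw [← Real.exp_add]; simp
    simp only [Pi.neg_apply]
    field_simp
    linear_combination (c * volterraSolution t j c x * f x) * h1

theorem hasDerivAt_mode (hf : IsProfile f) (ht : IsLogCoord f t) (hj : 0 < j)
    (c : ℝ) {x : ℝ} (hx : x ∈ Ioo (-1:ℝ) 1) :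
    HasDerivAt (fun x => Real.exp (j * t x) * volterraSolution t j c x)
      (modeFlux t j c x / f x) x := by
  refine (((ht.hasDerivAt x hx).const_mul j).exp.mul
    (ht.hasDerivAt_volterraSolution hf hj c hx)).congr_deriv ?_
  rw [modeFlux]
  have hne := (hf.pos x hx).ne'
  field_simp
  ring

theorem hasDerivAt_modeFlux (hf : IsProfile f) (ht : IsLogCoord f t) (hj : 0 < j)
    (c : ℝ) {x : ℝ} (hx : x ∈ Ioo (-1:ℝ) 1) :
    HasDerivAt (modeFlux t j c)
      ((j ^ 2 / f x - 2 * j * c) * (Real.exp (j * t x) * volterraSolution t j c x)) x := by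
  have hexp := ((ht.hasDerivAt x hx).const_mul (2 * j)).neg.exp
  refine (((ht.hasDerivAt x hx).const_mul j).exp.mul
    (((ht.hasDerivAt_volterraSolution hf hj c hx).const_mul j).sub
      ((hexp.mul (ht.hasDerivAt_weightedIntegral hf hj c hx)).const_mul (2 * j * c)))).congr_deriv ?_
  have hne := (hf.pos x hx).ne'
  have h1 : Real.exp (-(2 * j * t x)) * Real.exp (2 * j * t x) = 1 := by
    rw [← Real.exp_add]; simp
  simp only [Pi.neg_apply, Pi.mul_apply, Pi.sub_apply]
  generalize Real.exp (2 * j * t x) = B at *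
  generalize Real.exp (-(2 * j * t x)) = A at *
  field_simp
  linear_combination (-2 * c * volterraSolution t j c x * f x) * h1

theorem contDiffOn_volterraSolution (hf : IsProfile f) (ht : IsLogCoord f t) (hj : 0 < j)
    (c : ℝ) (n : ℕ) : ContDiffOn ℝ n (volterraSolution t j c) (Ioo (-1) 1) := by
  induction n with
  | zero =>
    exact contDiffOn_zero.2 ((ht.continuousOn_volterraSolution hf hj c).mono Ioo_subset_Icc_self)
  | succ n ih =>
    have htn := ht.contDiffOn hf n
    have hW : ContDiffOn ℝ n (weightedIntegral t j c) (Ioo (-1) 1) :=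
      (contDiffOn_succ_of_hasDerivAt (fun x hx => ht.hasDerivAt_weightedIntegral hf hj c hx)
        ((contDiffOn_const.mul htn).exp.mul ih)).of_le (by exact_mod_cast n.le_succ)
    refine contDiffOn_succ_of_hasDerivAt
      (fun x hx => ht.hasDerivAt_volterraSolution hf hj c hx) ?_
    exact ((contDiffOn_const.mul ((contDiffOn_const.mul htn).neg.exp.mul hW)).neg).div
      (hf.smoothOn.of_le (by exact_mod_cast le_top)) fun x hx => (hf.pos x hx).ne'

theorem antitoneOn_volterraSolution (hf : IsProfile f) (ht : IsLogCoord f t) (hj : 0 < j)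
    {c : ℝ} (hc : 0 ≤ c) (hv : ∀ x ∈ Icc (-1:ℝ) 1, 0 ≤ volterraSolution t j c x) :
    AntitoneOn (volterraSolution t j c) (Icc (-1) 1) := by
  intro x hx x' hx' hxx
  rw [ht.volterraSolution_eq hf hj c hx, ht.volterraSolution_eq hf hj c hx']
  have hcont := ht.continuousOn_volterraSolution hf hj c
  have := setIntegral_mono_on (ht.integrableOn_volterraKernel_mul hj x hcont)
    (ht.integrableOn_volterraKernel_mul hj x' hcont) measurableSet_Ioo fun y hy =>
      mul_le_mul_of_nonneg_right (ht.monotone_volterraKernel hf hj y hxx)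
        (hv y (Ioo_subset_Icc_self hy))
  have := mul_le_mul_of_nonneg_left this hc
  linarith

theorem weightedIntegral_pos (hf : IsProfile f) (ht : IsLogCoord f t) (hj : 0 < j)
    {c : ℝ} (hv : ∀ x ∈ Icc (-1:ℝ) 1, 0 ≤ volterraSolution t j c x) {x : ℝ}
    (hx : x ∈ Ioo (-1:ℝ) 1) : 0 < weightedIntegral t j c x := by
  refine integral_pos hx.1 (ht.continuousOn_growth_mul_volterraSolution hf hj c hx.2)
    (fun y hy => mul_nonneg (growth_nonneg t j y) (hv y ⟨hy.1.le, hy.2.trans hx.2.le⟩)) ?_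
  have hcont := (ht.continuousOn_volterraSolution hf hj c).continuousWithinAt
    (left_mem_Icc.2 (by norm_num))
  have hpos : ∀ᶠ y in 𝓝[Icc (-1) 1] (-1:ℝ), 0 < volterraSolution t j c y :=
    hcont.eventually (lt_mem_nhds (by rw [ht.volterraSolution_neg_one hf hj]; exact one_pos))
  rw [nhdsWithin_Icc_eq_nhdsGE (by norm_num : (-1:ℝ) < 1)] at hpos
  have hpos' := hpos.filter_mono (nhdsWithin_mono _ Ioi_subset_Ici_self)
  obtain ⟨y, hy1, hy2⟩ := (hpos'.and (Ioo_mem_nhdsGT hx.1)).exists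
  exact ⟨y, Ioo_subset_Icc_self hy2, mul_pos
    (by rw [growth_of_mem t j ⟨hy2.1, hy2.2.trans hx.2⟩]; positivity) hy1⟩

/-- Splitting of the value at `x` of the Volterra solution relative to its value at `1`. -/
theorem volterraSolution_eq_add (hf : IsProfile f) (ht : IsLogCoord f t) (hj : 0 < j)
    (c : ℝ) {x : ℝ} (hx : x ∈ Ioo (-1:ℝ) 1) :
    volterraSolution t j c x = volterraSolution t j c 1 +
      c * ((∫ y in x..1, volterraSolution t j c y) +
        Real.exp (-(2 * j * t x)) * weightedIntegral t j c x) := by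
  have hcont := ht.continuousOn_volterraSolution hf hj c
  have := integral_add_adjacent_intervals (μ := volume)
    ((hcont.mono (Icc_subset_Icc_right hx.2.le)).intervalIntegrable_of_Icc hx.1.le)
    ((hcont.mono (Icc_subset_Icc_left hx.1.le)).intervalIntegrable_of_Icc hx.2.le)
  rw [ht.volterraSolution_eq_of_mem hf hj c hx, ht.volterraSolution_one hf hj c, ← this]
  ring

theorem volterraSolution_pos (hf : IsProfile f) (ht : IsLogCoord f t) (hj : 0 < j)
    {c : ℝ} (hc : 0 < c) (hv : ∀ x ∈ Icc (-1:ℝ) 1, 0 ≤ volterraSolution t j c x) {x : ℝ}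
    (hx : x ∈ Ioo (-1:ℝ) 1) : 0 < volterraSolution t j c x := by
  rw [ht.volterraSolution_eq_add hf hj c hx]
  have h1 := hv 1 (by norm_num)
  have h2 := ht.weightedIntegral_pos hf hj hv hx
  have h3 : 0 ≤ ∫ y in x..1, volterraSolution t j c y :=
    integral_nonneg hx.2.le fun y hy => hv y ⟨hx.1.le.trans hy.1, hy.2⟩
  positivity

end IsLogCoord

/-- Maximum principle: a solution of `(f u')' = a u` on `(-1,1)` vanishing at `±1` is nonpositive
as soon as `(f w')' < a w` for some `w` bounded below by a positive constant. -/
theorem nonpos_of_strict_supersolution {f u p w q q' a : ℝ → ℝ} {ε : ℝ} (hε : 0 < ε)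
    (hf : ∀ x ∈ Ioo (-1:ℝ) 1, 0 < f x)
    (hucont : ContinuousOn u (Icc (-1) 1)) (hu0 : u (-1) = 0) (hu1 : u 1 = 0)
    (hu : ∀ x ∈ Ioo (-1:ℝ) 1, HasDerivAt u (p x / f x) x)
    (hp : ∀ x ∈ Ioo (-1:ℝ) 1, HasDerivAt p (a x * u x) x)
    (hwε : ∀ x ∈ Ioo (-1:ℝ) 1, ε ≤ w x)
    (hw : ∀ x ∈ Ioo (-1:ℝ) 1, HasDerivAt w (q x / f x) x)
    (hq : ∀ x ∈ Ioo (-1:ℝ) 1, HasDerivAt q (q' x) x)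
    (hlt : ∀ x ∈ Ioo (-1:ℝ) 1, q' x < a x * w x) :
    ∀ x ∈ Ioo (-1:ℝ) 1, u x ≤ 0 := by
  intro x₀ hx₀
  by_contra! hpos
  have hwpos : ∀ x ∈ Ioo (-1:ℝ) 1, 0 < w x := fun x hx => hε.trans_le (hwε x hx)
  set r : ℝ → ℝ := (Ioo (-1:ℝ) 1).indicator fun x => u x / w x with hr
  have hr_mem : ∀ x ∈ Ioo (-1:ℝ) 1, r x = u x / w x := fun x hx => indicator_of_mem hx _
  have hr_le : ∀ x, ‖r x‖ ≤ ‖u x‖ / ε := by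
    intro x
    by_cases hx : x ∈ Ioo (-1:ℝ) 1
    · rw [hr_mem x hx, norm_div, Real.norm_of_nonneg (hwpos x hx).le]
      exact div_le_div_of_nonneg_left (norm_nonneg _) hε (hwε x hx)
    · rw [hr, indicator_of_notMem hx, norm_zero]
      positivity
  have hrcont : ContinuousOn r (Icc (-1) 1) := by
    intro x hx
    by_cases hxI : x ∈ Ioo (-1:ℝ) 1
    · refine ContinuousAt.continuousWithinAt ?_
      refine ((hu x hxI).continuousAt.div (hw x hxI).continuousAt (hwpos x hxI).ne').congr ?_
      filter_upwards [isOpen_Ioo.mem_nhds hxI] with y hy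
      exact (hr_mem y hy).symm
    · have hux : u x = 0 := by
        rcases eq_endpoints_or_mem_Ioo_of_mem_Icc hx with h | h | h
        · rw [h, hu0]
        · rw [h, hu1]
        · exact absurd h hxI
      have hrx : r x = 0 := indicator_of_notMem hxI _
      rw [ContinuousWithinAt, hrx]
      refine squeeze_zero_norm hr_le ?_
      have := (hucont x hx).norm.div_const ε
      rwa [ContinuousWithinAt, hux, norm_zero, zero_div] at this
  obtain ⟨x₁, hx₁, hmax⟩ := isCompact_Icc.exists_isMaxOn (nonempty_Icc.2 (by norm_num)) hrcont
  set M := r x₁ with hM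
  have hMpos : 0 < M := by
    have h1 : r x₀ ≤ M := hmax (Ioo_subset_Icc_self hx₀)
    rw [hr_mem x₀ hx₀] at h1
    exact (div_pos hpos (hwpos x₀ hx₀)).trans_le h1
  have hx₁I : x₁ ∈ Ioo (-1:ℝ) 1 := by
    by_contra h
    exact hMpos.ne' (indicator_of_notMem h _)
  have hgle : ∀ x ∈ Ioo (-1:ℝ) 1, u x - M * w x ≤ 0 := by
    intro x hx
    have h1 : r x ≤ M := hmax (Ioo_subset_Icc_self hx)
    rw [hr_mem x hx, div_le_iff₀ (hwpos x hx)] at h1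
    linarith
  have hg₁ : u x₁ - M * w x₁ = 0 := by
    rw [hM, hr_mem x₁ hx₁I, div_mul_cancel₀ _ (hwpos x₁ hx₁I).ne', sub_self]
  have hgder : ∀ x ∈ Ioo (-1:ℝ) 1,
      HasDerivAt (fun x => u x - M * w x) ((p x - M * q x) / f x) x := by
    intro x hx
    exact ((hu x hx).sub ((hw x hx).const_mul M)).congr_deriv (by ring)
  have hloc : IsLocalMax (fun x => u x - M * w x) x₁ := by
    filter_upwards [isOpen_Ioo.mem_nhds hx₁I] with x hx
    rw [hg₁]
    exact hgle x hx
  have hflux₁ : p x₁ - M * q x₁ = 0 := by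
    have h1 := hloc.hasDerivAt_eq_zero (hgder x₁ hx₁I)
    exact (div_eq_zero_iff.1 h1).resolve_right (hf x₁ hx₁I).ne'
  have hfder : HasDerivAt (fun x => p x - M * q x) (a x₁ * u x₁ - M * q' x₁) x₁ :=
    (hp x₁ hx₁I).sub ((hq x₁ hx₁I).const_mul M)
  have hderpos : 0 < a x₁ * u x₁ - M * q' x₁ := by
    have h1 := mul_lt_mul_of_pos_left (hlt x₁ hx₁I) hMpos
    have h2 : u x₁ = M * w x₁ := by linarith
    rw [h2]
    linarith
  have hev : ∀ᶠ x in 𝓝[>] x₁, 0 < p x - M * q x := by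
    have h1 := hasDerivAt_iff_tendsto_slope.1 hfder
    have h2 := (h1.eventually (lt_mem_nhds hderpos)).filter_mono
      (nhdsWithin_mono _ fun y (hy : x₁ < y) => hy.ne')
    filter_upwards [h2, self_mem_nhdsWithin] with x hx hxx
    have hxx' : 0 < x - x₁ := sub_pos.2 hxx
    rw [slope_def_field, hflux₁, sub_zero] at hx
    exact (div_pos_iff_of_pos_right hxx').1 hx
  obtain ⟨b, hb, hbsub⟩ := (mem_nhdsGT_iff_exists_Ioo_subset' hx₁I.2).1 hev
  set y := (x₁ + min b 1) / 2 with hy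
  have hb' : x₁ < min b 1 := lt_min hb hx₁I.2
  have hyb : y < b := by linarith [min_le_left b 1]
  have hy1 : y < 1 := by linarith [min_le_right b 1]
  have hy₁ : x₁ < y := by linarith
  have hsubI : Icc x₁ y ⊆ Ioo (-1:ℝ) 1 := fun x hx => ⟨hx₁I.1.trans_le hx.1, hx.2.trans_lt hy1⟩
  have hstrict : StrictMonoOn (fun x => u x - M * w x) (Icc x₁ y) := by
    refine strictMonoOn_of_deriv_pos (convex_Icc _ _)
      (fun x hx => (hgder x (hsubI hx)).continuousAt.continuousWithinAt) fun x hx => ?_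
    have hxI := hsubI (interior_subset hx)
    rw [interior_Icc] at hx
    rw [(hgder x hxI).deriv]
    exact div_pos (hbsub ⟨hx.1, hx.2.trans hyb⟩) (hf x hxI)
  have h1 := hstrict (left_mem_Icc.2 hy₁.le) (right_mem_Icc.2 hy₁.le) hy₁
  simp only [hg₁] at h1
  exact absurd (hgle y (hsubI (right_mem_Icc.2 hy₁.le))) (not_le.2 h1)

/-- For `k ≥ 1`, a strict positive supersolution of `L_k - lam` excludes `lam` from the
spectrum of `L_k`. -/
theorem not_inSpec_of_strict_supersolution {f w q q' : ℝ → ℝ} {ε lam : ℝ} {k : ℕ} (hk : 1 ≤ k)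
    (hε : 0 < ε) (hf : IsProfile f)
    (hwε : ∀ x ∈ Ioo (-1:ℝ) 1, ε ≤ w x)
    (hw : ∀ x ∈ Ioo (-1:ℝ) 1, HasDerivAt w (q x / f x) x)
    (hq : ∀ x ∈ Ioo (-1:ℝ) 1, HasDerivAt q (q' x) x)
    (hlt : ∀ x ∈ Ioo (-1:ℝ) 1, q' x < ((k:ℝ) ^ 2 / f x - lam) * w x) :
    ¬ InSpec f k lam := by
  rintro ⟨u, hucont, husmooth, ⟨x₀, hx₀, hne⟩, hbc, hode⟩
  obtain ⟨hu0, hu1⟩ := hbc hk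
  have hu : ∀ x ∈ Ioo (-1:ℝ) 1, HasDerivAt u (f x * deriv u x / f x) x := by
    intro x hx
    rw [mul_div_cancel_left₀ _ (hf.pos x hx).ne']
    exact ((husmooth.contDiffAt (isOpen_Ioo.mem_nhds hx)).differentiableAt (by simp)).hasDerivAt
  have hp : ∀ x ∈ Ioo (-1:ℝ) 1, HasDerivAt (fun x => f x * deriv u x)
      (((k:ℝ) ^ 2 / f x - lam) * u x) x := by
    intro x hx
    have hd : ContDiffOn ℝ 1 (deriv u) (Ioo (-1) 1) :=
      husmooth.deriv_of_isOpen isOpen_Ioo (WithTop.coe_le_coe.2 le_top)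
    have h1 : DifferentiableAt ℝ (fun x => f x * deriv u x) x :=
      ((hf.smoothOn.contDiffAt (isOpen_Ioo.mem_nhds hx)).differentiableAt (by simp)).mul
        ((hd.contDiffAt (isOpen_Ioo.mem_nhds hx)).differentiableAt (by simp))
    refine h1.hasDerivAt.congr_deriv ?_
    linarith [hode x hx]
  have hle := nonpos_of_strict_supersolution hε hf.pos hucont hu0 hu1 hu hp hwε hw hq hlt x₀ hx₀
  have hge := nonpos_of_strict_supersolution (u := fun x => -u x)
    (p := fun x => -(f x * deriv u x)) hε hf.pos hucont.neg (by simp [hu0]) (by simp [hu1])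
    (fun x hx => (hu x hx).neg.congr_deriv (by ring))
    (fun x hx => (hp x hx).neg.congr_deriv (by ring)) hwε hw hq hlt x₀ hx₀
  exact hne (by linarith)

theorem InSpec.pos {f : ℝ → ℝ} (hf : IsProfile f) {k : ℕ} (hk : 1 ≤ k) {lam : ℝ}
    (h : InSpec f k lam) : 0 < lam := by
  by_contra! hlam
  refine not_inSpec_of_strict_supersolution (w := fun _ => 1) (q := fun _ => 0) (q' := fun _ => 0)
    hk one_pos hf (fun _ _ => le_rfl) (fun x _ => by simpa using hasDerivAt_const x (1:ℝ))
    (fun x _ => hasDerivAt_const x (0:ℝ)) (fun x hx => ?_) h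
  have hk' : (0:ℝ) < k := by exact_mod_cast hk
  have := div_pos (pow_pos hk' 2) (hf.pos x hx)
  linarith

theorem inSpec_zero_zero (f : ℝ → ℝ) : InSpec f 0 0 :=
  ⟨fun _ => 1, continuousOn_const, contDiffOn_const, ⟨0, by norm_num, one_ne_zero⟩,
    fun h => absurd h (by norm_num), fun x _ => by simp⟩

namespace IsLogCoord

variable {f t : ℝ → ℝ}

/-- Comparison of angular momenta: if `lam` lies in the spectrum of `L_k` and `0 < j < k`, then the
Volterra solution for `L_j - lam` takes negative values. -/
theorem exists_volterraSolution_neg (hf : IsProfile f) (ht : IsLogCoord f t) {j : ℝ} (hj : 0 < j)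
    {k : ℕ} (hjk : j < k) {lam : ℝ} (h : InSpec f k lam) :
    ∃ x ∈ Icc (-1:ℝ) 1, volterraSolution t j (lam / (2 * j)) x < 0 := by
  by_contra! hv
  have hk : 1 ≤ k := by
    have : (0:ℝ) < k := hj.trans hjk
    exact_mod_cast this
  have hlam := h.pos hf hk
  set c := lam / (2 * j) with hc
  have hc0 : 0 < c := by positivity
  have hcj : 2 * j * c = lam := by rw [hc]; field_simp
  have hkpos : (0:ℝ) < (k:ℝ) ^ 2 := by positivity
  have hgap : 0 < (k:ℝ) ^ 2 - j ^ 2 := by nlinarith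
  set w : ℝ → ℝ := fun x => Real.exp (j * t x) * volterraSolution t j c x with hw
  have hwpos : ∀ x ∈ Ioo (-1:ℝ) 1, 0 < w x := fun x hx =>
    mul_pos (Real.exp_pos _) (ht.volterraSolution_pos hf hj hc0 hv hx)
  set A : Set ℝ := Icc (-1) 1 ∩ (fun x => lam * f x) ⁻¹' Ici ((k:ℝ) ^ 2) with hA
  have hAcomp : IsCompact A := isCompact_Icc.of_isClosed_subset
    ((continuousOn_const.mul hf.contOn).preimage_isClosed_of_isClosed isClosed_Icc isClosed_Ici)
    inter_subset_left
  have hAsub : A ⊆ Ioo (-1:ℝ) 1 := by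
    intro x hx
    have hx2 : (k:ℝ) ^ 2 ≤ lam * f x := hx.2
    rcases eq_endpoints_or_mem_Ioo_of_mem_Icc hx.1 with e | e | e
    · rw [e, hf.zero_neg_one] at hx2; linarith
    · rw [e, hf.zero_one] at hx2; linarith
    · exact e
  obtain ⟨m, hm, hmle⟩ := hAcomp.exists_forall_le' (f := w) (a := 0)
    (fun x hx => (ht.hasDerivAt_mode hf hj c (hAsub hx)).continuousAt.continuousWithinAt)
    fun x hx => hwpos x (hAsub hx)
  obtain ⟨F, hF⟩ := isCompact_Icc.bddAbove_image hf.contOn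
  have hFle : ∀ x ∈ Icc (-1:ℝ) 1, f x ≤ F := fun x hx => hF (mem_image_of_mem f hx)
  have hF0 : 0 ≤ F := by
    have := hFle 1 (by norm_num)
    rwa [hf.zero_one] at this
  set ε := m * ((k:ℝ) ^ 2 - j ^ 2) / (lam * F + 1) with hε
  have hden : 0 < lam * F + 1 := by positivity
  have hε0 : 0 < ε := by positivity
  have hεF : ε * (lam * F) + ε = m * ((k:ℝ) ^ 2 - j ^ 2) := by
    rw [hε]; field_simp
  refine not_inSpec_of_strict_supersolution (w := fun x => w x + ε) (q := modeFlux t j c) hk hε0 hf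
    (fun x hx => by linarith [hwpos x hx]) (fun x hx => (ht.hasDerivAt_mode hf hj c hx).add_const ε)
    (fun x hx => ht.hasDerivAt_modeFlux hf hj c hx) (fun x hx => ?_) h
  have hfx := hf.pos x hx
  have hkey : 0 < ((k:ℝ) ^ 2 - j ^ 2) * w x + ε * ((k:ℝ) ^ 2 - lam * f x) := by
    by_cases hxA : x ∈ A
    · have h1 := hmle x hxA
      have h2 := mul_le_mul_of_nonneg_left h1 hgap.le
      have h3 := mul_le_mul_of_nonneg_left
        (mul_le_mul_of_nonneg_left (hFle x hxA.1) hlam.le) hε0.le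
      have h4 := mul_pos hε0 hkpos
      nlinarith
    · have h1 : lam * f x < (k:ℝ) ^ 2 := by
        by_contra! h2
        exact hxA ⟨Ioo_subset_Icc_self hx, h2⟩
      have := mul_pos hgap (hwpos x hx)
      have := mul_pos hε0 (sub_pos.2 h1)
      linarith
  have hdiff : ((k:ℝ) ^ 2 / f x - lam) * (w x + ε) - (j ^ 2 / f x - 2 * j * c) * w x =
      (((k:ℝ) ^ 2 - j ^ 2) * w x + ε * ((k:ℝ) ^ 2 - lam * f x)) / f x := by
    rw [hcj]
    field_simp
    ring
  have := div_pos hkey hfx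
  linarith

/-- If the nonnegative Volterra solution vanishes at `1`, then the mode `exp (jt) v` decays. -/
theorem tendsto_mode_one (hf : IsProfile f) (ht : IsLogCoord f t) {j : ℝ} (hj : 0 < j) {c : ℝ}
    (hc : 0 < c) (hv : ∀ x ∈ Icc (-1:ℝ) 1, 0 ≤ volterraSolution t j c x)
    (hv1 : volterraSolution t j c 1 = 0) :
    Tendsto (fun x => Real.exp (j * t x) * volterraSolution t j c x) (𝓝[<] 1) (𝓝 0) := by
  have hanti := ht.antitoneOn_volterraSolution hf hj hc.le hv
  set a := max 0 (1 - 1 / (2 * c)) with ha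
  have ha0 : 0 ≤ a := le_max_left _ _
  have hac : 1 - 1 / (2 * c) ≤ a := le_max_right _ _
  have ha1 : a < 1 := max_lt one_pos (sub_lt_self _ (by positivity))
  have hI : ∀ x ∈ Ico a 1, x ∈ Ioo (-1:ℝ) 1 := fun x hx => ⟨by linarith [hx.1], hx.2⟩
  have hvle : ∀ x ∈ Ico a 1, volterraSolution t j c x ≤
      2 * c * (Real.exp (-(2 * j * t x)) * weightedIntegral t j c x) := by
    intro x hx
    have h1 := ht.volterraSolution_eq_add hf hj c (hI x hx)
    have h2 : ∫ y in x..1, volterraSolution t j c y ≤ (1 - x) * volterraSolution t j c x := by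
      have := integral_mono_on (μ := volume) (g := fun _ => volterraSolution t j c x) hx.2.le
        (((ht.continuousOn_volterraSolution hf hj c).mono
          (Icc_subset_Icc_left (hI x hx).1.le)).intervalIntegrable_of_Icc hx.2.le)
        intervalIntegrable_const
        fun y hy => hanti (Ioo_subset_Icc_self (hI x hx)) ⟨(hI x hx).1.le.trans hy.1, hy.2⟩ hy.1
      simpa using this
    have h3 : c * (1 - x) ≤ 1 / 2 := by
      have : 1 - x ≤ 1 / (2 * c) := by linarith [hx.1]
      calc c * (1 - x) ≤ c * (1 / (2 * c)) := mul_le_mul_of_nonneg_left this hc.le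
        _ = 1 / 2 := by field_simp
    have h4 := mul_le_mul_of_nonneg_left h2 hc.le
    have h5 := mul_le_mul_of_nonneg_right h3 (hv x (Ioo_subset_Icc_self (hI x hx)))
    rw [hv1] at h1
    linarith
  have hgr : AntitoneOn (fun x => weightedIntegral t j c x * Real.exp (-(2 * c * x))) (Ico a 1) := by
    have hder : ∀ x ∈ Ico a 1,
        HasDerivAt (fun x => weightedIntegral t j c x * Real.exp (-(2 * c * x)))
          ((Real.exp (2 * j * t x) * volterraSolution t j c x - 2 * c * weightedIntegral t j c x) *
            Real.exp (-(2 * c * x))) x := by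
      intro x hx
      have h1 : HasDerivAt (fun x : ℝ => -(2 * c * x)) (-(2 * c)) x := by
        exact ((hasDerivAt_id x).const_mul (2 * c)).neg.congr_deriv (by ring)
      exact ((ht.hasDerivAt_weightedIntegral hf hj c (hI x hx)).mul h1.exp).congr_deriv (by ring)
    refine antitoneOn_of_deriv_nonpos (convex_Ico a 1)
      (fun x hx => (hder x hx).continuousAt.continuousWithinAt)
      (fun x hx => (hder x (interior_subset hx)).differentiableAt.differentiableWithinAt) ?_
    intro x hx
    have hx' := interior_subset hx
    rw [(hder x hx').deriv]
    refine mul_nonpos_of_nonpos_of_nonneg ?_ (Real.exp_pos _).le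
    have h1 := mul_le_mul_of_nonneg_left (hvle x hx') (Real.exp_pos (2 * j * t x)).le
    have h2 : Real.exp (-(2 * j * t x)) * Real.exp (2 * j * t x) = 1 := by
      rw [← Real.exp_add]; simp
    have h3 : Real.exp (2 * j * t x) *
        (2 * c * (Real.exp (-(2 * j * t x)) * weightedIntegral t j c x)) =
        2 * c * weightedIntegral t j c x := by
      linear_combination (2 * c * weightedIntegral t j c x) * h2
    linarith
  set B := weightedIntegral t j c a * Real.exp (-(2 * c * a)) * Real.exp (2 * c) with hB
  have hWle : ∀ x ∈ Ico a 1, weightedIntegral t j c x ≤ B := by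
    intro x hx
    have h1 := hgr ⟨le_rfl, ha1⟩ hx hx.1
    have h2 := mul_le_mul_of_nonneg_right h1 (Real.exp_pos (2 * c)).le
    have h3 : 1 ≤ Real.exp (-(2 * c * x)) * Real.exp (2 * c) := by
      rw [← Real.exp_add]
      exact Real.one_le_exp (by nlinarith [hx.2])
    have h4 := mul_le_mul_of_nonneg_left h3 (ht.weightedIntegral_pos hf hj hv (hI x hx)).le
    simp only at h2
    linarith
  have hlim : Tendsto (fun x => 2 * c * B * Real.exp (-(j * t x))) (𝓝[<] 1) (𝓝 0) := by
    have := (Real.tendsto_exp_neg_atTop_nhds_zero.comp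
      (ht.tendsto_atTop.const_mul_atTop hj)).const_mul (2 * c * B)
    rwa [mul_zero] at this
  refine tendsto_of_tendsto_of_tendsto_of_le_of_le' tendsto_const_nhds hlim ?_ ?_
  · filter_upwards [Ico_mem_nhdsLT ha1] with x hx
    exact mul_nonneg (Real.exp_pos _).le (hv x (Ioo_subset_Icc_self (hI x hx)))
  · filter_upwards [Ico_mem_nhdsLT ha1] with x hx
    have h1 : Real.exp (j * t x) * Real.exp (-(2 * j * t x)) = Real.exp (-(j * t x)) := by
      rw [← Real.exp_add]; congr 1; ring
    calc Real.exp (j * t x) * volterraSolution t j c x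
        ≤ Real.exp (j * t x) *
          (2 * c * (Real.exp (-(2 * j * t x)) * weightedIntegral t j c x)) :=
          mul_le_mul_of_nonneg_left (hvle x hx) (Real.exp_pos _).le
      _ = 2 * c * weightedIntegral t j c x * Real.exp (-(j * t x)) := by rw [← h1]; ring
      _ ≤ 2 * c * B * Real.exp (-(j * t x)) := by
          have := hWle x hx
          gcongr

/-- A nonnegative Volterra solution vanishing at `1` yields an eigenvalue. -/
theorem inSpec_of_volterraSolution_one_eq_zero (hf : IsProfile f) (ht : IsLogCoord f t) {j : ℕ}
    (hj : 1 ≤ j) {c : ℝ} (hc : 0 < c) (hv : ∀ x ∈ Icc (-1:ℝ) 1, 0 ≤ volterraSolution t j c x)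
    (hv1 : volterraSolution t j c 1 = 0) : InSpec f j (2 * j * c) := by
  have hj0 : (0:ℝ) < j := by exact_mod_cast hj
  set w : ℝ → ℝ := fun x => Real.exp (j * t x) * volterraSolution t j c x with hw
  set u : ℝ → ℝ := (Ioo (-1:ℝ) 1).indicator w with hu
  have hu_mem : EqOn u w (Ioo (-1) 1) := eqOn_indicator
  have hu0 : u (-1) = 0 := indicator_of_notMem (by simp) _
  have hu1 : u 1 = 0 := indicator_of_notMem (by simp) _
  have hev : ∀ x ∈ Ioo (-1:ℝ) 1, u =ᶠ[𝓝 x] w := fun x hx =>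
    hu_mem.eventuallyEq_of_mem (isOpen_Ioo.mem_nhds hx)
  have hder : ∀ x ∈ Ioo (-1:ℝ) 1, HasDerivAt u (modeFlux t j c x / f x) x := fun x hx =>
    (ht.hasDerivAt_mode hf hj0 c hx).congr_of_eventuallyEq (hev x hx)
  have hleft : Tendsto w (𝓝[>] (-1)) (𝓝 0) := by
    have h1 := (ht.continuousOn_volterraSolution hf hj0 c).continuousWithinAt
      (left_mem_Icc.2 (by norm_num))
    rw [ContinuousWithinAt, nhdsWithin_Icc_eq_nhdsGE (by norm_num : (-1:ℝ) < 1)] at h1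
    have h2 := (Real.tendsto_exp_atBot.comp (ht.tendsto_atBot.const_mul_atBot hj0)).mul
      (h1.mono_left (nhdsWithin_mono _ Ioi_subset_Ici_self))
    rwa [zero_mul] at h2
  refine ⟨u, ?_, ?_, ?_, fun _ => ⟨hu0, hu1⟩, fun x hx => ?_⟩
  · intro x hx
    rcases eq_endpoints_or_mem_Ioo_of_mem_Icc hx with rfl | rfl | h
    · have h1 : ContinuousWithinAt u (Ioi (-1)) (-1) := by
        rw [ContinuousWithinAt, hu0]
        refine hleft.congr' ?_
        filter_upwards [Ioo_mem_nhdsGT (by norm_num : (-1:ℝ) < 1)] with y hy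
        exact (hu_mem hy).symm
      exact (continuousWithinAt_Ioi_iff_Ici.1 h1).mono Icc_subset_Ici_self
    · have h1 : ContinuousWithinAt u (Iio 1) 1 := by
        rw [ContinuousWithinAt, hu1]
        refine (ht.tendsto_mode_one hf hj0 hc hv hv1).congr' ?_
        filter_upwards [Ioo_mem_nhdsLT (by norm_num : (-1:ℝ) < 1)] with y hy
        exact (hu_mem hy).symm
      exact (continuousWithinAt_Iio_iff_Iic.1 h1).mono Icc_subset_Iic_self
    · exact (hder x h).continuousAt.continuousWithinAt
  · refine ContDiffOn.congr (contDiffOn_infty.2 fun n => ?_) hu_mem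
    exact (contDiffOn_const.mul (ht.contDiffOn hf n)).exp.mul
      (ht.contDiffOn_volterraSolution hf hj0 c n)
  · refine ⟨0, by norm_num, ?_⟩
    rw [hu_mem (by norm_num)]
    exact (mul_pos (Real.exp_pos _) (ht.volterraSolution_pos hf hj0 hc hv (by norm_num))).ne'
  · have hflux : (fun y => f y * deriv u y) =ᶠ[𝓝 x] modeFlux t j c := by
      filter_upwards [isOpen_Ioo.mem_nhds hx] with y hy
      rw [(hder y hy).deriv, mul_div_cancel₀ _ (hf.pos y hy).ne']
    rw [hflux.deriv_eq, (ht.hasDerivAt_modeFlux hf hj0 c hx).deriv, hu_mem hx]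
    ring

end IsLogCoord

/-- Every eigenvalue of `L_{k+1}` lies strictly above some eigenvalue of `L_k`. -/
theorem InSpec.exists_lt {f : ℝ → ℝ} (hf : IsProfile f) {k : ℕ} {lam : ℝ}
    (h : InSpec f (k + 1) lam) : ∃ lam' < lam, InSpec f k lam' := by
  have hlam := h.pos hf (Nat.le_add_left 1 k)
  rcases Nat.eq_zero_or_pos k with rfl | hk
  · exact ⟨0, hlam, inSpec_zero_zero f⟩
  obtain ⟨t, ht⟩ := hf.exists_isLogCoord
  have hk0 : (0:ℝ) < k := by exact_mod_cast hk
  obtain ⟨x₀, hx₀, hneg⟩ := ht.exists_volterraSolution_neg hf hk0 (by push_cast; linarith) h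
  set C := lam / (2 * k) with hC
  have hC0 : 0 < C := by positivity
  have hcont : ContinuousOn (fun p : ℝ × ℝ => volterraSolution t k p.1 p.2)
      (Icc 0 C ×ˢ Icc (-1) 1) :=
    (ht.continuousOn_volterraSolution_uncurry hf hk0 C).mono
      (prod_mono (Icc_subset_Icc_left (by linarith)) Subset.rfl)
  set S : Set (ℝ × ℝ) := (Icc 0 C ×ˢ Icc (-1) 1) ∩
    (fun p : ℝ × ℝ => volterraSolution t k p.1 p.2) ⁻¹' Iic 0 with hS
  have hSc : IsCompact S := (isCompact_Icc.prod isCompact_Icc).of_isClosed_subset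
    (hcont.preimage_isClosed_of_isClosed (isClosed_Icc.prod isClosed_Icc) isClosed_Iic)
    inter_subset_left
  obtain ⟨c, ⟨⟨c', x₁⟩, ⟨⟨hc, hx₁⟩, hle⟩, rfl⟩, hmin⟩ :=
    (hSc.image continuous_fst).exists_isLeast
      ⟨C, (C, x₀), ⟨⟨⟨hC0.le, le_rfl⟩, hx₀⟩, hneg.le⟩, rfl⟩
  simp only at hc hx₁ hmin
  replace hle : volterraSolution t k c' x₁ ≤ 0 := hle
  have hbelow : ∀ c ∈ Ico 0 c', ∀ x ∈ Icc (-1:ℝ) 1, 0 < volterraSolution t k c x := by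
    intro c hcc x hx
    by_contra! hcon
    exact absurd (hmin ⟨(c, x), ⟨⟨⟨hcc.1, hcc.2.le.trans hc.2⟩, hx⟩, hcon⟩, rfl⟩)
      (not_le.2 hcc.2)
  have hcpos : 0 < c' := by
    rcases hc.1.eq_or_lt with h0 | h0
    · rw [← h0, ht.volterraSolution_eq hf hk0 0 hx₁] at hle
      norm_num at hle
    · exact h0
  have hnonneg : ∀ x ∈ Icc (-1:ℝ) 1, 0 ≤ volterraSolution t k c' x := by
    intro x hx
    have h1 : ContinuousOn (fun c => volterraSolution t k c x) (Icc 0 C) :=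
      hcont.comp (f := fun c => (c, x)) (by fun_prop) fun c hcc => ⟨hcc, hx⟩
    have h2 : Tendsto (fun c => volterraSolution t k c x) (𝓝[Ico 0 c'] c')
        (𝓝 (volterraSolution t k c' x)) :=
      (h1 c' hc).mono fun c hcc => ⟨hcc.1, hcc.2.le.trans hc.2⟩
    have : (𝓝[Ico 0 c'] c').NeBot := by
      rw [← mem_closure_iff_nhdsWithin_neBot, closure_Ico hcpos.ne]
      exact ⟨hc.1, le_rfl⟩
    refine ge_of_tendsto h2 ?_
    filter_upwards [self_mem_nhdsWithin] with c hcc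
    exact (hbelow c hcc x hx).le
  have hlt : c' < C := by
    refine lt_of_le_of_ne hc.2 fun e => ?_
    rw [e] at hnonneg
    exact absurd (hnonneg x₀ hx₀) (not_le.2 hneg)
  have hone : volterraSolution t k c' 1 = 0 :=
    le_antisymm ((ht.antitoneOn_volterraSolution hf hk0 hcpos.le hnonneg hx₁
      (right_mem_Icc.2 (by norm_num)) hx₁.2).trans hle) (hnonneg 1 (by norm_num))
  refine ⟨2 * k * c', ?_, ht.inSpec_of_volterraSolution_one_eq_zero hf hk hcpos hnonneg hone⟩
  have h1 : 2 * k * C = lam := by rw [hC]; field_simp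
  rw [← h1]
  gcongr

theorem le_of_mem_Spec {f : ℝ → ℝ} (hf : IsProfile f) {Λ : ℕ → ℝ} (hΛmono : StrictMono Λ)
    (hΛrange : Set.range Λ = Eigs f) {k m : ℕ} (h : Λ m ∈ Spec f k) : k ≤ m := by
  induction k generalizing m with
  | zero => exact Nat.zero_le m
  | succ k ih =>
    obtain ⟨lam, hlt, hlam⟩ := InSpec.exists_lt hf h
    obtain ⟨m', rfl⟩ : lam ∈ Set.range Λ := hΛrange ▸ mem_iUnion.2 ⟨k, hlam⟩
    exact (ih hlam).trans_lt (hΛmono.lt_iff_lt.1 hlt)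

/-- Multiplicity bound: the multiplicity of the `m`-th distinct Laplace eigenvalue is at
most `2m + 1`. -/
theorem multiplicity_le (f : ℝ → ℝ) (hf : IsProfile f)
    (Λ : ℕ → ℝ) (hΛmono : StrictMono Λ) (hΛrange : Set.range Λ = Eigs f) :
    ∀ m : ℕ,
      2 * ({k : ℕ | 1 ≤ k ∧ Λ m ∈ Spec f k}).ncard
        + (if Λ m ∈ Spec f 0 then 1 else 0) ≤ 2 * m + 1 := by
  intro m
  have hsub : {k : ℕ | 1 ≤ k ∧ Λ m ∈ Spec f k} ⊆ Finset.Icc 1 m := fun k hk =>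
    Finset.mem_coe.2 (Finset.mem_Icc.2 ⟨hk.1, le_of_mem_Spec hf hΛmono hΛrange hk.2⟩)
  have hcard := Set.ncard_le_ncard hsub (Finset.finite_toSet _)
  rw [Set.ncard_coe_finset, Nat.card_Icc] at hcard
  split_ifs <;> omega
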